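/- arXiv:math/0508264 — 8 statements merged into one kernel-verified Lean document; each statement's English description precedes it below -/
import Mathlib

section
/- For every natural number n and every real ξ, the limit as a → ∞ of (-1)^n (2a)^{n/2} C_n^{(a)}(a + ξ√(2a)) equals H_n(ξ). That is, the function a ↦ (-1)^n (2a)^{n/2} · Σ_{k=0}^{n} (n choose k) · (∏_{i=0}^{k-1} ((a + ξ√(2a)) - i)) · (-1/a)^k tends to H_n(ξ) as a → ∞ (along the filter atTop on ℝ, restricted to a > 0). -/
/-- The (physicists') Hermite polynomial
`H_n(x) = n! Σ_{k=0}^{⌊n/2⌋} (-1)^k / (k!(n-2k)!) (2x)^{n-2k}`. -/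
noncomputable def hermite (n : ℕ) (x : ℝ) : ℝ :=
  (n.factorial : ℝ) * ∑ k ∈ Finset.range (n / 2 + 1),
    (-1 : ℝ) ^ k / ((k.factorial : ℝ) * ((n - 2 * k).factorial : ℝ)) * (2 * x) ^ (n - 2 * k)

/-- The Charlier polynomial
`C_n^{(a)}(x) = Σ_{k=0}^{n} (n choose k) x(x-1)⋯(x-k+1) (-1/a)^k`. -/
noncomputable def charlier (n : ℕ) (a x : ℝ) : ℝ :=
  ∑ k ∈ Finset.range (n + 1),
    (n.choose k : ℝ) * (∏ i ∈ Finset.range k, (x - i)) * (-1 / a) ^ k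

/-- Three-term recurrence for the polynomials `Σ_k (n choose k) (∏_{i<k} (x - i)) b^k`. -/
theorem sum_choose_mul_fallingFactorial_recurrence (n : ℕ) (b x : ℝ) :
    ∑ k ∈ Finset.range (n + 3),
        ((n + 2).choose k : ℝ) * (∏ i ∈ Finset.range k, (x - i)) * b ^ k =
      (1 + b * (x - (n + 1))) * ∑ k ∈ Finset.range (n + 2),
        ((n + 1).choose k : ℝ) * (∏ i ∈ Finset.range k, (x - i)) * b ^ k +
      (n + 1) * b * ∑ k ∈ Finset.range (n + 1),
        (n.choose k : ℝ) * (∏ i ∈ Finset.range k, (x - i)) * b ^ k := by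
  have pascal : ∑ k ∈ Finset.range (n + 3),
        ((n + 2).choose k : ℝ) * (∏ i ∈ Finset.range k, (x - i)) * b ^ k =
      ∑ k ∈ Finset.range (n + 2),
        ((n + 1).choose k : ℝ) * (∏ i ∈ Finset.range k, (x - i)) * b ^ k +
      ∑ k ∈ Finset.range (n + 2),
        ((n + 1).choose k : ℝ) * (∏ i ∈ Finset.range (k + 1), (x - i)) * b ^ (k + 1) := by
    have extend : ∑ k ∈ Finset.range (n + 2),
        ((n + 1).choose k : ℝ) * (∏ i ∈ Finset.range k, (x - i)) * b ^ k =
        ∑ k ∈ Finset.range (n + 3),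
        ((n + 1).choose k : ℝ) * (∏ i ∈ Finset.range k, (x - i)) * b ^ k := by
      rw [Finset.sum_range_succ _ (n + 2), Nat.choose_succ_self]
      simp
    rw [extend, Finset.sum_range_succ' _ (n + 2), Finset.sum_range_succ' _ (n + 2),
      add_right_comm, ← Finset.sum_add_distrib]
    congr 1
    refine Finset.sum_congr rfl fun k _ => ?_
    rw [Nat.choose_succ_succ' (n + 1) k]
    push_cast
    ring
  have extend : ∑ k ∈ Finset.range (n + 1),
      (n.choose k : ℝ) * (∏ i ∈ Finset.range k, (x - i)) * b ^ k =
      ∑ k ∈ Finset.range (n + 2),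
      (n.choose k : ℝ) * (∏ i ∈ Finset.range k, (x - i)) * b ^ k := by
    rw [Finset.sum_range_succ _ (n + 1), Nat.choose_succ_self]
    simp
  rw [pascal, extend, add_mul, one_mul, add_assoc, add_right_inj, Finset.mul_sum,
    Finset.mul_sum, ← Finset.sum_add_distrib]
  refine Finset.sum_congr rfl fun k hk => ?_
  have hk' : k ≤ n + 1 := Nat.lt_succ_iff.mp (Finset.mem_range.mp hk)
  have hc : ((n : ℝ) + 1) * (n.choose k : ℝ) = ((n + 1).choose k : ℝ) * (n + 1 - k) := by
    have h := Nat.choose_mul_succ_eq n k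
    have h' : ((n.choose k * (n + 1) : ℕ) : ℝ) = (((n + 1).choose k * (n + 1 - k) : ℕ) : ℝ) := by
      rw [h]
    push_cast [Nat.cast_sub hk'] at h'
    linarith
  rw [Finset.prod_range_succ]
  linear_combination (-(∏ i ∈ Finset.range k, (x - i)) * b ^ (k + 1)) * hc

theorem charlier_recurrence (n : ℕ) (a x : ℝ) :
    charlier (n + 2) a x = (1 + -1 / a * (x - (n + 1))) * charlier (n + 1) a x +
      (n + 1) * (-1 / a) * charlier n a x :=
  sum_choose_mul_fallingFactorial_recurrence n (-1 / a) x

/-- The Hermite polynomial as a sum of any sufficient length, with coefficients that vanish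
beyond the degree. -/
theorem hermite_eq_sum (n N : ℕ) (hN : n / 2 + 1 ≤ N) (x : ℝ) :
    hermite n x = ∑ k ∈ Finset.range N,
      (-1 : ℝ) ^ k * ((n.choose (2 * k) : ℝ) * (2 * k).factorial / k.factorial) *
        (2 * x) ^ (n - 2 * k) := by
  rw [hermite, Finset.mul_sum]
  refine Eq.trans (Finset.sum_congr rfl fun k hk => ?_)
    (Finset.sum_subset (Finset.range_mono hN) fun k _ hk => ?_)
  · have hk' : 2 * k ≤ n := by
      have := Finset.mem_range.mp hk
      omega
    have hf : (n.factorial : ℝ) =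
        (n.choose (2 * k) : ℝ) * (2 * k).factorial * (n - 2 * k).factorial := by
      exact_mod_cast (Nat.choose_mul_factorial_mul_factorial hk').symm
    have h1 : (k.factorial : ℝ) ≠ 0 := by positivity
    have h2 : ((n - 2 * k).factorial : ℝ) ≠ 0 := by positivity
    rw [hf]
    field_simp
  · have hk' : n < 2 * k := by
      rw [Finset.mem_range] at hk
      omega
    simp [Nat.choose_eq_zero_of_lt hk']

theorem hermite_recurrence (n : ℕ) (x : ℝ) :
    hermite (n + 2) x = 2 * x * hermite (n + 1) x - 2 * (n + 1) * hermite n x := by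
  rw [hermite_eq_sum (n + 2) (n / 2 + 2) (by omega),
    hermite_eq_sum (n + 1) (n / 2 + 2) (by omega), hermite_eq_sum n (n / 2 + 1) le_rfl,
    Finset.sum_range_succ' _ (n / 2 + 1), Finset.sum_range_succ' _ (n / 2 + 1), mul_add,
    Finset.mul_sum, Finset.mul_sum, add_sub_right_comm, ← Finset.sum_sub_distrib]
  congr 1
  · refine Finset.sum_congr rfl fun k _ => ?_
    have hpow : ((n + 1).choose (2 * k + 2) : ℝ) * (2 * x) ^ (n - 2 * k) =
        ((n + 1).choose (2 * k + 2) : ℝ) * ((2 * x) * (2 * x) ^ (n + 1 - (2 * k + 2))) := by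
      rcases Nat.lt_or_ge (n + 1) (2 * k + 2) with h | h
      · simp [Nat.choose_eq_zero_of_lt h]
      · rw [← pow_succ', show n + 1 - (2 * k + 2) + 1 = n - 2 * k by omega]
    have habs : ((n + 1).choose (2 * k + 1) : ℝ) * (2 * k + 1) = (n + 1) * n.choose (2 * k) := by
      exact_mod_cast (Nat.add_one_mul_choose_eq n (2 * k)).symm
    have hk : (k.factorial : ℝ) ≠ 0 := by positivity
    have hk1 : (k : ℝ) + 1 ≠ 0 := by positivity
    rw [show 2 * (k + 1) = 2 * k + 2 by ring, show n + 2 - (2 * k + 2) = n - 2 * k by omega,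
      Nat.choose_succ_succ' (n + 1) (2 * k + 1), Nat.factorial_succ (2 * k + 1),
      Nat.factorial_succ (2 * k), Nat.factorial_succ k]
    generalize (2 * x) ^ (n + 1 - (2 * k + 2)) = p at *
    push_cast
    field_simp
    linear_combination (-(-1 : ℝ) ^ k * (2 * k + 1 + 1) * (2 * k + 1)) * hpow -
      2 * (k + 1) * (-1 : ℝ) ^ k * (2 * x) ^ (n - 2 * k) * habs
  · simp [pow_succ']

open Filter Topology in
theorem tendsto_sqrt_pow_mul_charlier (n : ℕ) (ξ : ℝ) :
    Tendsto (fun a : ℝ => (-1 : ℝ) ^ n * √(2 * a) ^ n * charlier n a (a + ξ * √(2 * a)))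
      atTop (𝓝 (hermite n ξ)) := by
  have hs : Tendsto (fun a : ℝ => 2 / √(2 * a)) atTop (𝓝 0) :=
    Tendsto.div_atTop tendsto_const_nhds
      (Real.tendsto_sqrt_atTop.comp (tendsto_id.const_mul_atTop two_pos))
  induction n using Nat.twoStepInduction with
  | zero => simp [charlier, hermite]
  | one =>
    have h : hermite 1 ξ = 2 * ξ := by simp [hermite]
    rw [h]
    refine tendsto_const_nhds.congr' ?_
    filter_upwards [eventually_gt_atTop 0] with a ha
    have hsq : √(2 * a) ^ 2 = 2 * a := Real.sq_sqrt (by positivity)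
    simp only [charlier, Finset.sum_range_succ, Finset.prod_range_succ]
    generalize √(2 * a) = s at *
    simp
    field_simp
    linear_combination (-ξ) * hsq
  | more n ih0 ih1 =>
    have hlim := ((hs.const_mul ((n : ℝ) + 1)).const_sub (2 * ξ)).mul ih1 |>.sub
      (ih0.const_mul (2 * ((n : ℝ) + 1)))
    rw [mul_zero, sub_zero, ← hermite_recurrence] at hlim
    refine hlim.congr' ?_
    filter_upwards [eventually_gt_atTop 0] with a ha
    have hs0 : √(2 * a) ≠ 0 := by positivity
    have hsq : a = √(2 * a) ^ 2 / 2 := by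
      rw [Real.sq_sqrt (by positivity)]
      ring
    rw [charlier_recurrence]
    generalize charlier (n + 1) a _ = c₁
    generalize charlier n a _ = c₀
    generalize √(2 * a) = s at *
    subst hsq
    field_simp
    ring

/-- The limit relation between the Charlier and Hermite polynomials:
`lim_{a→∞} (-1)^n (2a)^{n/2} C_n^{(a)}(a + ξ√(2a)) = H_n(ξ)`. -/
theorem charlier_to_hermite_limit (n : ℕ) (ξ : ℝ) :
    Filter.Tendsto
      (fun a : ℝ => (-1 : ℝ) ^ n * (2 * a) ^ ((n : ℝ) / 2) *
        charlier n a (a + ξ * Real.sqrt (2 * a)))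
      (Filter.atTop ⊓ Filter.principal (Set.Ioi (0 : ℝ)))
      (nhds (hermite n ξ)) := by
  refine ((tendsto_sqrt_pow_mul_charlier n ξ).mono_left inf_le_left).congr' ?_
  filter_upwards [Filter.mem_inf_of_right (Filter.mem_principal_self _)] with a ha
  rw [Real.rpow_div_two_eq_sqrt _ (mul_nonneg two_pos.le (le_of_lt ha)), Real.rpow_natCast]
end

section
/- Let n ≥ 1 be a natural number and ξ < -√(2n) a real number, and set σ = √(ξ² - 2n). Define, for a > 0 and x = a + ξ√(2a), Δ = √(a² - 2a(x+n) + (x-n)²) and L₃(x) = √((a - x - n + Δ)/(2Δ)). Then the limit as a → ∞ of L₃(a + ξ√(2a)) equals U₁(ξ) := √((1 - ξ/σ)/2). -/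
/-- For `ξ < -√(2n)` and `σ = √(ξ² - 2n)`, the amplitude `L₃` of the Charlier
asymptotics satisfies `L₃(a + ξ√(2a)) → U₁(ξ) = √((1 - ξ/σ)/2)` as `a → ∞`. -/
theorem l3_limit (n : ℕ) (hn : 1 ≤ n) (ξ : ℝ) (hξ : ξ < -Real.sqrt (2 * n))
    (σ : ℝ) (hσ : σ = Real.sqrt (ξ ^ 2 - 2 * n)) :
    Filter.Tendsto
      (fun a : ℝ =>
        let x : ℝ := a + ξ * Real.sqrt (2 * a)
        let Δ : ℝ := Real.sqrt (a ^ 2 - 2 * a * (x + n) + (x - n) ^ 2)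
        Real.sqrt ((a - x - n + Δ) / (2 * Δ)))
      Filter.atTop
      (nhds (Real.sqrt ((1 - ξ / σ) / 2))) := by
  have hpos : 0 < ξ ^ 2 - 2 * n := by
    have h := Real.sqrt_nonneg (2 * (n : ℝ))
    have h2 := Real.sq_sqrt (show (0 : ℝ) ≤ 2 * n by positivity)
    nlinarith
  have hσpos : 0 < σ := hσ ▸ Real.sqrt_pos.mpr hpos
  let D : ℝ → ℝ := fun t => Real.sqrt (ξ ^ 2 - 2 * n - 2 * n * ξ * t + n ^ 2 * t ^ 2)
  have hD0 : D 0 = σ := by simp [D, hσ]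
  have hDcont : Continuous D := by fun_prop
  have hcont : ContinuousAt (fun t => Real.sqrt ((-ξ - n * t + D t) / (2 * D t))) 0 := by
    refine Real.continuous_sqrt.continuousAt.comp (ContinuousAt.div ?_ ?_ ?_)
    · fun_prop
    · fun_prop
    · rw [hD0]
      positivity
  have hinv : Filter.Tendsto (fun a : ℝ => (Real.sqrt (2 * a))⁻¹) Filter.atTop (nhds 0) :=
    (Real.tendsto_sqrt_atTop.comp
      (Filter.tendsto_id.const_mul_atTop (two_pos : (0 : ℝ) < 2))).inv_tendsto_atTop
  have hval : Real.sqrt ((-ξ - n * 0 + D 0) / (2 * D 0)) = Real.sqrt ((1 - ξ / σ) / 2) := by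
    rw [hD0]
    congr 1
    field_simp
    ring
  rw [← hval]
  refine (hcont.tendsto.comp hinv).congr' ?_
  filter_upwards [Filter.eventually_gt_atTop 0] with a ha
  have hs : 0 < Real.sqrt (2 * a) := Real.sqrt_pos.mpr (by positivity)
  have hsq : Real.sqrt (2 * a) ^ 2 = 2 * a := Real.sq_sqrt (by positivity)
  simp only [Function.comp_apply]
  set s := Real.sqrt (2 * a)
  have ha' : a = s ^ 2 / 2 := by linarith
  have hΔ : Real.sqrt (a ^ 2 - 2 * a * (a + ξ * s + n) + (a + ξ * s - n) ^ 2) = s * D s⁻¹ := by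
    have h : a ^ 2 - 2 * a * (a + ξ * s + n) + (a + ξ * s - n) ^ 2 =
        s ^ 2 * (ξ ^ 2 - 2 * n - 2 * n * ξ * s⁻¹ + n ^ 2 * s⁻¹ ^ 2) := by
      rw [ha']
      field_simp
      ring
    rw [h, Real.sqrt_mul (sq_nonneg s), Real.sqrt_sq hs.le]
  rw [hΔ]
  congr 1
  rw [show a - (a + ξ * s) - n + s * D s⁻¹ = s * (-ξ - n * s⁻¹ + D s⁻¹) by
      field_simp
      ring,
    show 2 * (s * D s⁻¹) = s * (2 * D s⁻¹) by ring, mul_div_mul_left _ _ hs.ne']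
end

section
/- Let n ≥ 1 be a natural number and ξ > √(2n) a real number, and set σ = √(ξ² - 2n). Define, for a > 0 and x = a + ξ√(2a), Δ = √(a² - 2a(x+n) + (x-n)²) and Ψ₄(x) = x·ln((a + x - n - Δ)/(2a)) + n·ln((x - a - n + Δ)/(2a)) + (a - x - n + Δ)/2. Then the limit as a → ∞ of (n/2)·ln(2a) + Ψ₄(a + ξ√(2a)) equals Φ₂(ξ) := n·ln(σ + ξ) + (ξ² - σξ - n)/2. -/
open Filter Topology in
/-- Second-order expansion of the logarithm along a filter:
`(log (1 + e u) - e u) / e² → -L² / 2` if `e → 0` through nonzero values and `u → L`. -/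
theorem tendsto_log_one_add_mul_sub_div_sq {ι : Type*} {l : Filter ι} {e u : ι → ℝ} {L : ℝ}
    (he : Tendsto e l (𝓝 0)) (he0 : ∀ᶠ i in l, e i ≠ 0) (hu : Tendsto u l (𝓝 L)) :
    Tendsto (fun i => (Real.log (1 + e i * u i) - e i * u i) / e i ^ 2) l (𝓝 (-L ^ 2 / 2)) := by
  have ht : Tendsto (fun i => |e i * u i|) l (𝓝 0) := by
    simpa using (he.mul hu).abs
  have hbound : Tendsto (fun i => |e i| * |u i| ^ 3 / (1 - |e i * u i|)) l (𝓝 0) := by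
    simpa [Pi.div_def] using (he.abs.mul (hu.abs.pow 3)).div (ht.const_sub 1) (by norm_num)
  have hrem : Tendsto
      (fun i => (Real.log (1 + e i * u i) - e i * u i) / e i ^ 2 + u i ^ 2 / 2) l (𝓝 0) := by
    refine squeeze_zero_norm' ?_ hbound
    filter_upwards [he0, ht.eventually_lt_const one_pos] with i hi hlt
    have hlog := Real.abs_log_sub_add_sum_range_le (x := -(e i * u i)) (by rwa [abs_neg]) 2
    rw [Real.norm_eq_abs]
    have hsq : 0 < |e i| ^ 2 := by positivity
    have hpos : 0 < 1 - |e i * u i| := by linarith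
    have heq : (Real.log (1 + e i * u i) - e i * u i) / e i ^ 2 + u i ^ 2 / 2 =
        (∑ k ∈ Finset.range 2, (-(e i * u i)) ^ (k + 1) / ((k : ℝ) + 1)
          + Real.log (1 - -(e i * u i))) / e i ^ 2 := by
      simp only [Finset.sum_range_succ, Finset.sum_range_zero, sub_neg_eq_add]
      field_simp
      push_cast
      ring
    rw [heq, abs_div, abs_pow, div_le_iff₀ hsq]
    refine hlog.trans (le_of_eq ?_)
    rw [abs_neg, abs_mul]
    ring
  have h := hrem.sub ((hu.pow 2).div_const 2)
  rw [zero_sub, ← neg_div] at h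
  exact h.congr fun i => by ring

open Filter Topology in
/-- First-order expansion of the logarithm along a filter: `log (1 + e u) / e → L` if `e → 0`
through nonzero values and `u → L`. -/
theorem tendsto_log_one_add_mul_div {ι : Type*} {l : Filter ι} {e u : ι → ℝ} {L : ℝ}
    (he : Tendsto e l (𝓝 0)) (he0 : ∀ᶠ i in l, e i ≠ 0) (hu : Tendsto u l (𝓝 L)) :
    Tendsto (fun i => Real.log (1 + e i * u i) / e i) l (𝓝 L) := by
  have h := ((tendsto_log_one_add_mul_sub_div_sq he he0 hu).mul he).add hu
  rw [mul_zero, zero_add] at h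
  refine h.congr' ?_
  filter_upwards [he0] with i hi
  field_simp
  ring

/-- For `ξ > √(2n)` and `σ = √(ξ² - 2n)`, the exponent `Ψ₄` of the Charlier
asymptotics satisfies `(n/2)ln(2a) + Ψ₄(a + ξ√(2a)) → Φ₂(ξ) = n ln(σ + ξ) + (ξ² - σξ - n)/2`
as `a → ∞`. -/
theorem psi4_limit (n : ℕ) (hn : 1 ≤ n) (ξ : ℝ) (hξ : Real.sqrt (2 * n) < ξ)
    (σ : ℝ) (hσ : σ = Real.sqrt (ξ ^ 2 - 2 * n)) :
    Filter.Tendsto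
      (fun a : ℝ =>
        let x : ℝ := a + ξ * Real.sqrt (2 * a)
        let Δ : ℝ := Real.sqrt (a ^ 2 - 2 * a * (x + n) + (x - n) ^ 2)
        ((n : ℝ) / 2) * Real.log (2 * a) +
          (x * Real.log ((a + x - n - Δ) / (2 * a)) +
            (n : ℝ) * Real.log ((x - a - n + Δ) / (2 * a)) +
            (a - x - n + Δ) / 2))
      Filter.atTop
      (nhds ((n : ℝ) * Real.log (σ + ξ) + (ξ ^ 2 - σ * ξ - n) / 2)) := by
  open Filter Topology in
  have hξ0 : 0 < ξ := (Real.sqrt_nonneg _).trans_lt hξ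
  have hσ0 : 0 ≤ σ := hσ ▸ Real.sqrt_nonneg _
  have hσsq : σ ^ 2 = ξ ^ 2 - 2 * n := by
    rw [hσ, Real.sq_sqrt]
    linarith [(Real.sqrt_lt' hξ0).1 hξ]
  -- `e = 1 / √(2a)` is the small parameter, and `D e = Δ / √(2a)`.
  set e : ℝ → ℝ := fun a => (Real.sqrt (2 * a))⁻¹ with he_def
  have he : Tendsto e atTop (𝓝 0) :=
    tendsto_inv_atTop_zero.comp
      (Real.tendsto_sqrt_atTop.comp (tendsto_id.const_mul_atTop two_pos))
  have hpos : ∀ᶠ a in atTop, 0 < e a := by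
    filter_upwards [eventually_gt_atTop (0 : ℝ)] with a ha
    exact inv_pos.2 (Real.sqrt_pos.2 (by positivity))
  have he0 : ∀ᶠ a in atTop, e a ≠ 0 := hpos.mono fun _ h => h.ne'
  set D : ℝ → ℝ := fun t => Real.sqrt (σ ^ 2 - 2 * n * ξ * t + n ^ 2 * t ^ 2) with hD_def
  have hD : Tendsto (fun a => D (e a)) atTop (𝓝 σ) := by
    have hc : Continuous D := by fun_prop
    have h0 : D 0 = σ := by simp [hD_def, Real.sqrt_sq hσ0]
    exact h0 ▸ (hc.tendsto 0).comp he
  have hu : Tendsto (fun a => ξ - n * e a - D (e a)) atTop (𝓝 (ξ - σ)) := by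
    simpa using ((he.const_mul (n : ℝ)).const_sub ξ).sub hD
  have hv : Tendsto (fun a => ξ - n * e a + D (e a)) atTop (𝓝 (σ + ξ)) := by
    simpa [add_comm] using ((he.const_mul (n : ℝ)).const_sub ξ).add hD
  have hlim := ((hv.log (by positivity)).const_mul (n : ℝ)).add
    ((((tendsto_log_one_add_mul_sub_div_sq he he0 hu).div_const 2).add
      ((tendsto_log_one_add_mul_div he he0 hu).const_mul ξ)).sub_const (n : ℝ))
  have hval : (n : ℝ) * Real.log (σ + ξ) + (-(ξ - σ) ^ 2 / 2 / 2 + ξ * (ξ - σ) - n) =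
      (n : ℝ) * Real.log (σ + ξ) + (ξ ^ 2 - σ * ξ - n) / 2 := by
    linear_combination (-1 / 4 : ℝ) * hσsq
  rw [hval] at hlim
  refine hlim.congr' ?_
  filter_upwards [eventually_gt_atTop (0 : ℝ), hpos,
    hv.eventually_const_lt (by positivity : 0 < σ + ξ)] with a ha hea hva
  have hs : Real.sqrt (2 * a) = (e a)⁻¹ := (inv_inv _).symm
  have h2a : 2 * a = ((e a)⁻¹) ^ 2 := by rw [← hs, Real.sq_sqrt (by positivity)]
  generalize e a = t at *
  obtain rfl : a = (t⁻¹) ^ 2 / 2 := by linarith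
  dsimp only
  rw [hs]
  have hΔ : Real.sqrt (((t⁻¹) ^ 2 / 2) ^ 2
      - 2 * ((t⁻¹) ^ 2 / 2) * ((t⁻¹) ^ 2 / 2 + ξ * t⁻¹ + n)
      + ((t⁻¹) ^ 2 / 2 + ξ * t⁻¹ - n) ^ 2) = t⁻¹ * D t := by
    rw [← Real.sqrt_sq (inv_pos.2 hea).le, hD_def, ← Real.sqrt_mul (sq_nonneg _), hσsq,
      Real.sqrt_sq (inv_pos.2 hea).le]
    congr 1
    field_simp
    ring
  rw [hΔ]
  generalize D t = d at *
  have harg₁ : ((t⁻¹) ^ 2 / 2 + ((t⁻¹) ^ 2 / 2 + ξ * t⁻¹) - n - t⁻¹ * d) / (2 * ((t⁻¹) ^ 2 / 2)) =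
      1 + t * (ξ - n * t - d) := by
    field_simp
    ring
  have harg₂ : ((t⁻¹) ^ 2 / 2 + ξ * t⁻¹ - (t⁻¹) ^ 2 / 2 - n + t⁻¹ * d) / (2 * ((t⁻¹) ^ 2 / 2)) =
      t * (ξ - n * t + d) := by
    field_simp
    ring
  rw [harg₁, harg₂, Real.log_mul hea.ne' hva.ne', h2a, Real.log_pow, Real.log_inv]
  field_simp
  push_cast
  ring
end

section
/- Let n ≥ 1 be a natural number and ξ > √(2n) a real number, and set σ = √(ξ² - 2n). Define, for a > 0 and x = a + ξ√(2a), Δ = √(a² - 2a(x+n) + (x-n)²) and L₄(x) = √((x - a + n + Δ)/(2Δ)). Then the limit as a → ∞ of L₄(a + ξ√(2a)) equals U₂(ξ) := √((1 + ξ/σ)/2). -/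
open Filter Topology in
/-- The rescaled amplitude, as a function of `t = 1 / √(2a)`, is continuous at `t = 0`. -/
theorem tendsto_rescaled_amplitude (c ξ σ : ℝ) (hσ : 0 < σ) :
    Tendsto
      (fun t : ℝ =>
        Real.sqrt ((ξ + c * t + Real.sqrt (σ ^ 2 - 2 * c * ξ * t + c ^ 2 * t ^ 2)) /
          (2 * Real.sqrt (σ ^ 2 - 2 * c * ξ * t + c ^ 2 * t ^ 2))))
      (𝓝 0) (𝓝 (Real.sqrt ((1 + ξ / σ) / 2))) := by
  have hroot : Real.sqrt (σ ^ 2 - 2 * c * ξ * 0 + c ^ 2 * 0 ^ 2) = σ := by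
    simp [Real.sqrt_sq hσ.le]
  have hval : (1 + ξ / σ) / 2 = (ξ + c * 0 + σ) / (2 * σ) := by
    field_simp
    ring
  have hcont : ContinuousAt
      (fun t : ℝ =>
        Real.sqrt ((ξ + c * t + Real.sqrt (σ ^ 2 - 2 * c * ξ * t + c ^ 2 * t ^ 2)) /
          (2 * Real.sqrt (σ ^ 2 - 2 * c * ξ * t + c ^ 2 * t ^ 2)))) 0 := by
    refine (ContinuousAt.div (by fun_prop) (by fun_prop) ?_).sqrt
    rw [hroot]
    positivity
  have h := hcont.tendsto
  rwa [hroot, ← hval] at h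

/-- With `s = √(2a)`, the discriminant factors as `s²` times a quadratic in `1 / s`. -/
theorem charlier_discriminant_eq (c ξ σ a s : ℝ) (hs : s ≠ 0) (hsa : s ^ 2 = 2 * a)
    (hσ2 : σ ^ 2 = ξ ^ 2 - 2 * c) :
    a ^ 2 - 2 * a * (a + ξ * s + c) + (a + ξ * s - c) ^ 2 =
      s ^ 2 * (σ ^ 2 - 2 * c * ξ * s⁻¹ + c ^ 2 * s⁻¹ ^ 2) := by
  obtain rfl : a = s ^ 2 / 2 := by linarith
  rw [hσ2]
  field_simp
  ring


/-- For `ξ > √(2n)` and `σ = √(ξ² - 2n)`, the amplitude `L₄` of the Charlier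
asymptotics satisfies `L₄(a + ξ√(2a)) → U₂(ξ) = √((1 + ξ/σ)/2)` as `a → ∞`. -/
theorem l4_limit (n : ℕ) (hn : 1 ≤ n) (ξ : ℝ) (hξ : Real.sqrt (2 * n) < ξ)
    (σ : ℝ) (hσ : σ = Real.sqrt (ξ ^ 2 - 2 * n)) :
    Filter.Tendsto
      (fun a : ℝ =>
        let x : ℝ := a + ξ * Real.sqrt (2 * a)
        let Δ : ℝ := Real.sqrt (a ^ 2 - 2 * a * (x + n) + (x - n) ^ 2)
        Real.sqrt ((x - a + n + Δ) / (2 * Δ)))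
      Filter.atTop
      (nhds (Real.sqrt ((1 + ξ / σ) / 2))) := by
  have hσ2_pos : 0 < ξ ^ 2 - 2 * n := by
    have := Real.lt_sq_of_sqrt_lt hξ
    linarith
  have hσ_pos : 0 < σ := hσ ▸ Real.sqrt_pos.2 hσ2_pos
  have hσ2 : σ ^ 2 = ξ ^ 2 - 2 * n := by rw [hσ, Real.sq_sqrt hσ2_pos.le]
  have hs : Filter.Tendsto (fun a : ℝ => (Real.sqrt (2 * a))⁻¹) Filter.atTop (nhds 0) :=
    tendsto_inv_atTop_zero.comp (Real.tendsto_sqrt_atTop.comp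
      (Filter.tendsto_id.const_mul_atTop (by norm_num : (0 : ℝ) < 2)))
  refine ((tendsto_rescaled_amplitude n ξ σ hσ_pos).comp hs).congr' ?_
  filter_upwards [Filter.eventually_gt_atTop 0] with a ha
  have hs_pos : 0 < Real.sqrt (2 * a) := Real.sqrt_pos.2 (by positivity)
  have hsa : Real.sqrt (2 * a) ^ 2 = 2 * a := Real.sq_sqrt (by positivity)
  simp only [Function.comp_apply]
  rw [charlier_discriminant_eq n ξ σ a _ hs_pos.ne' hsa hσ2, Real.sqrt_mul (sq_nonneg _),
    Real.sqrt_sq hs_pos.le]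
  generalize Real.sqrt (2 * a) = s at hs_pos
  congr 1
  rw [← mul_div_mul_left _ _ hs_pos.ne']
  congr 1
  · field_simp
    ring
  · ring
end

section
/- Let n ≥ 1 be a natural number and ξ a real number. Then the limit as a → ∞ (real a → +∞) of (n/2)·ln(2a) + (n/2)·ln(n/a) + (a + ξ√(2a))·ln(1 - √(n/a)) + √(an) - n equals Φ₃(ξ) := (n/2)·ln(2n) - 3n/2 - ξ√(2n). -/
/-- The second-order Taylor quotient of `log (1 - t)` at `0` tends to `-1/2`. -/
theorem tendsto_log_one_sub_add_div_sq :
    Filter.Tendsto (fun t : ℝ => (Real.log (1 - t) + t) / t ^ 2)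
      (nhdsWithin 0 (Set.Ioi 0)) (nhds (-1 / 2)) := by
  rw [tendsto_iff_norm_sub_tendsto_zero]
  have hlim : Filter.Tendsto (fun t : ℝ => t / (1 - t)) (nhdsWithin 0 (Set.Ioi 0)) (nhds 0) := by
    have h : ContinuousAt (fun t : ℝ => t / (1 - t)) 0 := by
      apply ContinuousAt.div <;> first | fun_prop | norm_num
    simpa using h.tendsto.mono_left nhdsWithin_le_nhds
  refine squeeze_zero' (Filter.Eventually.of_forall fun t => norm_nonneg _) ?_ hlim
  filter_upwards [Ioo_mem_nhdsGT (zero_lt_one (α := ℝ))] with t ⟨h0, h1⟩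
  have h := Real.abs_log_sub_add_sum_range_le (x := t) (by rwa [abs_of_pos h0]) 2
  rw [abs_of_pos h0] at h
  have hd : 0 < 1 - t := by linarith
  have he : (Real.log (1 - t) + t) / t ^ 2 - -1 / 2 =
      (t + t ^ 2 / 2 + Real.log (1 - t)) / t ^ 2 := by
    field_simp
    ring
  rw [he, Real.norm_eq_abs, abs_div, abs_of_pos (pow_pos h0 2), div_le_iff₀ (pow_pos h0 2)]
  norm_num [Finset.sum_range_succ] at h
  calc _ ≤ t ^ 3 / (1 - t) := h
    _ = _ := by ring

/-- The exponent of the Airy-type Charlier approximation near the lower turning point,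
under `x = a + ξ√(2a)`, tends to `Φ₃(ξ) = (n/2)ln(2n) - 3n/2 - ξ√(2n)` as `a → ∞`. -/
theorem phi3_limit (n : ℕ) (hn : 1 ≤ n) (ξ : ℝ) :
    Filter.Tendsto
      (fun a : ℝ =>
        ((n : ℝ) / 2) * Real.log (2 * a) + ((n : ℝ) / 2) * Real.log ((n : ℝ) / a) +
          (a + ξ * Real.sqrt (2 * a)) * Real.log (1 - Real.sqrt ((n : ℝ) / a)) +
          Real.sqrt (a * n) - n)
      Filter.atTop
      (nhds (((n : ℝ) / 2) * Real.log (2 * n) - 3 * n / 2 - ξ * Real.sqrt (2 * n))) := by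
  have hn0 : (0 : ℝ) < n := by exact_mod_cast hn
  have ht0 : Filter.Tendsto (fun a : ℝ => Real.sqrt ((n : ℝ) / a)) Filter.atTop (nhds 0) := by
    simpa using (Filter.Tendsto.const_div_atTop Filter.tendsto_id (n : ℝ)).sqrt
  have ht : Filter.Tendsto (fun a : ℝ => Real.sqrt ((n : ℝ) / a)) Filter.atTop
      (nhdsWithin 0 (Set.Ioi 0)) := by
    refine tendsto_nhdsWithin_iff.2 ⟨ht0, ?_⟩
    filter_upwards [Filter.eventually_gt_atTop 0] with a ha
    exact Real.sqrt_pos.2 (div_pos hn0 ha)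
  have hg := tendsto_log_one_sub_add_div_sq.comp ht
  have hmain := (((hg.const_mul (n : ℝ)).add
    (((ht0.mul hg).sub_const 1).const_mul (ξ * Real.sqrt (2 * n)))).const_add
      ((n : ℝ) / 2 * Real.log (2 * n))).sub_const (n : ℝ)
  refine (hmain.congr' ?_).trans (le_of_eq (congrArg nhds (by ring)))
  filter_upwards [Filter.eventually_gt_atTop 0] with a ha
  have hs : 0 < Real.sqrt a := Real.sqrt_pos.2 ha
  have hsn : 0 < Real.sqrt n := Real.sqrt_pos.2 hn0
  have hlog : Real.log (2 * n) = Real.log (2 * a) + Real.log (n / a) := by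
    rw [← Real.log_mul (by positivity) (by positivity)]
    congr 1
    field_simp
  simp only [Function.comp_apply]
  rw [hlog, Real.sqrt_div hn0.le, Real.sqrt_mul ha.le, Real.sqrt_mul zero_le_two,
    Real.sqrt_mul zero_le_two]
  have ha2 : Real.sqrt a ^ 2 = a := Real.sq_sqrt ha.le
  have hn2 : Real.sqrt n ^ 2 = (n : ℝ) := Real.sq_sqrt hn0.le
  generalize Real.log (1 - Real.sqrt n / Real.sqrt a) = L
  generalize Real.log (2 * a) = A
  generalize Real.log (n / a) = B
  generalize Real.sqrt a = s at *
  generalize Real.sqrt n = r at *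
  rw [← ha2, ← hn2]
  field_simp
  ring
end

section
/- Let n ≥ 1 be a natural number and ξ a real number. Then the limit as a → ∞ (real a → +∞) of (n/2)·ln(2a) + (n/2)·ln(n/a) + (a + ξ√(2a))·ln(1 + √(n/a)) - √(an) - n equals Φ₄(ξ) := (n/2)·ln(2n) - 3n/2 + ξ√(2n). -/
/-- The second-order expansion of `log (1 + t)` as `t → 0⁺`. -/
lemma tendsto_log_one_add_sub_div_sq :
    Filter.Tendsto (fun t : ℝ => (Real.log (1 + t) - t) / t ^ 2)
      (nhdsWithin 0 (Set.Ioi 0)) (nhds (-1 / 2)) := by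
  rw [tendsto_iff_norm_sub_tendsto_zero]
  have hbound : Filter.Tendsto (fun t : ℝ => t / (1 - t)) (nhdsWithin 0 (Set.Ioi 0)) (nhds 0) := by
    have h : ContinuousAt (fun t : ℝ => t / (1 - t)) 0 :=
      continuousAt_id.div (by fun_prop) (by norm_num)
    simpa using h.tendsto.mono_left nhdsWithin_le_nhds
  refine squeeze_zero' (Filter.Eventually.of_forall fun _ => norm_nonneg _) ?_ hbound
  filter_upwards [Ioo_mem_nhdsGT (zero_lt_one' ℝ)] with t ht
  have ht0 : 0 < t := ht.1
  have h1 : 0 < 1 - t := sub_pos.2 ht.2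
  have h := Real.abs_log_sub_add_sum_range_le (x := -t)
    (by rw [abs_neg, abs_of_pos ht0]; exact ht.2) 2
  rw [abs_neg, abs_of_pos ht0] at h
  norm_num [Finset.sum_range_succ] at h
  have heq : (Real.log (1 + t) - t) / t ^ 2 - -1 / 2
      = (-t + t ^ 2 / 2 + Real.log (1 + t)) / t ^ 2 := by
    field_simp
    ring
  rw [heq, Real.norm_eq_abs, abs_div, abs_of_pos (pow_pos ht0 2), div_le_iff₀ (pow_pos ht0 2)]
  calc _ ≤ t ^ 3 / (1 - t) := h
    _ = t / (1 - t) * t ^ 2 := by ring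

lemma tendsto_log_one_add_div :
    Filter.Tendsto (fun t : ℝ => Real.log (1 + t) / t)
      (nhdsWithin 0 (Set.Ioi 0)) (nhds 1) := by
  have hid : Filter.Tendsto (fun t : ℝ => t) (nhdsWithin 0 (Set.Ioi 0)) (nhds 0) :=
    nhdsWithin_le_nhds
  have h := (hid.mul tendsto_log_one_add_sub_div_sq).const_add 1
  rw [zero_mul, add_zero] at h
  refine h.congr' ?_
  filter_upwards [self_mem_nhdsWithin] with t ht
  have ht0 : t ≠ 0 := ne_of_gt ht
  field_simp
  ring

/-- The exponent of the Airy-type Charlier approximation near the upper turning point,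
under `x = a + ξ√(2a)`, tends to `Φ₄(ξ) = (n/2)ln(2n) - 3n/2 + ξ√(2n)` as `a → ∞`. -/
theorem phi4_limit (n : ℕ) (hn : 1 ≤ n) (ξ : ℝ) :
    Filter.Tendsto
      (fun a : ℝ =>
        ((n : ℝ) / 2) * Real.log (2 * a) + ((n : ℝ) / 2) * Real.log ((n : ℝ) / a) +
          (a + ξ * Real.sqrt (2 * a)) * Real.log (1 + Real.sqrt ((n : ℝ) / a)) -
          Real.sqrt (a * n) - n)
      Filter.atTop
      (nhds (((n : ℝ) / 2) * Real.log (2 * n) - 3 * n / 2 + ξ * Real.sqrt (2 * n))) := by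
  have hn0 : (0 : ℝ) < n := by exact_mod_cast hn
  have ht : Filter.Tendsto (fun a : ℝ => Real.sqrt ((n : ℝ) / a)) Filter.atTop
      (nhdsWithin 0 (Set.Ioi 0)) := by
    refine tendsto_nhdsWithin_iff.2 ⟨?_, ?_⟩
    · simpa using (Filter.tendsto_id.const_div_atTop (n : ℝ)).sqrt
    · filter_upwards [Filter.eventually_gt_atTop 0] with a ha
      exact Real.sqrt_pos.2 (div_pos hn0 ha)
  have h := (((tendsto_log_one_add_sub_div_sq.comp ht).const_mul (n : ℝ)).add
    ((tendsto_log_one_add_div.comp ht).const_mul (ξ * Real.sqrt (2 * n)))).const_add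
    ((n : ℝ) / 2 * Real.log (2 * n) - n)
  convert h.congr' ?_ using 2
  · ring
  filter_upwards [Filter.eventually_gt_atTop 0] with a ha
  simp only [Function.comp_apply]
  have hlog : Real.log (2 * n) = Real.log (2 * a) + Real.log (n / a) := by
    rw [← Real.log_mul (by positivity) (by positivity)]
    congr 1
    field_simp
  have htpos : 0 < Real.sqrt ((n : ℝ) / a) := Real.sqrt_pos.2 (div_pos hn0 ha)
  have hsq : a * Real.sqrt ((n : ℝ) / a) ^ 2 = n := by
    rw [Real.sq_sqrt (by positivity)]
    field_simp
  have h2n : Real.sqrt (2 * n) = Real.sqrt (2 * a) * Real.sqrt (n / a) := by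
    rw [← Real.sqrt_mul (by positivity)]
    congr 1
    field_simp
  have han : Real.sqrt (a * n) = a * Real.sqrt (n / a) := by
    rw [Real.sqrt_eq_iff_mul_self_eq (by positivity) (by positivity)]
    linear_combination -a * hsq
  have hdiv : (n : ℝ) * ((Real.log (1 + Real.sqrt (n / a)) - Real.sqrt (n / a)) /
      Real.sqrt (n / a) ^ 2) = a * (Real.log (1 + Real.sqrt (n / a)) - Real.sqrt (n / a)) := by
    rw [mul_div_assoc', div_eq_iff (by positivity)]
    linear_combination -(Real.log (1 + Real.sqrt (n / a)) - Real.sqrt (n / a)) * hsq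
  have hlin : ξ * Real.sqrt (2 * n) * (Real.log (1 + Real.sqrt (n / a)) / Real.sqrt (n / a))
      = ξ * Real.sqrt (2 * a) * Real.log (1 + Real.sqrt (n / a)) := by
    rw [h2n, mul_div_assoc', div_eq_iff htpos.ne']
    ring
  rw [hdiv, hlin, hlog, han]
  ring
end

section
/- Let n ≥ 1 be a natural number and θ a real number with -π/2 < θ < π/2. Set ξ = √(2n)·sin(θ) (a real number) and σ = i·√(2n)·cos(θ) (a purely imaginary complex number). Then the principal complex square root of (1 - ξ/σ)/2 equals exp(iθ/2)/√(2cos(θ)). (Here the principal square root is given by the principal power z^{1/2} = exp((1/2)·Log z).) -/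
/-- For `cos θ ≠ 0`, the number `(1 + i tan θ)/2` equals `exp(iθ)/(2 cos θ)`. -/
theorem one_sub_sin_div_I_mul_cos_div_two {r θ : ℝ} (hr : r ≠ 0) (hθ : Real.cos θ ≠ 0) :
    (1 - ((r * Real.sin θ : ℝ) : ℂ) / (Complex.I * r * Real.cos θ)) / 2 =
      Complex.exp (Complex.I * θ) / ((2 * Real.cos θ : ℝ) : ℂ) := by
  have hr' : (r : ℂ) ≠ 0 := Complex.ofReal_ne_zero.mpr hr
  have hθ' : Complex.cos θ ≠ 0 := by
    rw [← Complex.ofReal_cos]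
    exact Complex.ofReal_ne_zero.mpr hθ
  rw [mul_comm Complex.I (θ : ℂ), Complex.exp_mul_I]
  push_cast
  field_simp
  linear_combination -Complex.sin θ * Complex.I_sq

open Real in
/-- In the oscillatory region, with `ξ = √(2n) sin θ` and `σ = i√(2n) cos θ`,
the principal complex square root of `(1 - ξ/σ)/2` equals `exp(iθ/2)/√(2cos θ)`. -/
theorem U1_oscillatory (n : ℕ) (hn : 1 ≤ n) (θ : ℝ)
    (h1 : -(π / 2) < θ) (h2 : θ < π / 2)
    (ξ : ℝ) (hξ : ξ = Real.sqrt (2 * n) * Real.sin θ)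
    (σ : ℂ) (hσ : σ = Complex.I * Real.sqrt (2 * n) * Real.cos θ) :
    ((1 - (ξ : ℂ) / σ) / 2) ^ ((1 : ℂ) / 2) =
      Complex.exp (Complex.I * θ / 2) / (Real.sqrt (2 * Real.cos θ) : ℂ) := by
  have hcos : 0 < Real.cos θ := Real.cos_pos_of_mem_Ioo ⟨h1, h2⟩
  have hr : 0 < Real.sqrt (2 * n) := Real.sqrt_pos.mpr (by positivity)
  have hsq : (Complex.exp (Complex.I * θ / 2) / (Real.sqrt (2 * Real.cos θ) : ℂ)) ^ 2 =
      Complex.exp (Complex.I * θ) / ((2 * Real.cos θ : ℝ) : ℂ) := by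
    rw [div_pow, ← Complex.exp_nat_mul, ← Complex.ofReal_pow, Real.sq_sqrt (by positivity)]
    congr 2
    push_cast
    ring
  have hre : 0 < (Complex.exp (Complex.I * θ / 2) / (Real.sqrt (2 * Real.cos θ) : ℂ)).re := by
    have hhalf : Complex.I * θ / 2 = ((θ / 2 : ℝ) : ℂ) * Complex.I := by
      push_cast
      ring
    rw [Complex.div_ofReal_re, hhalf, Complex.exp_ofReal_mul_I_re]
    have : 0 < Real.cos (θ / 2) :=
      Real.cos_pos_of_mem_Ioo ⟨by linarith [Real.pi_pos], by linarith [Real.pi_pos]⟩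
    positivity
  rw [hξ, hσ, one_sub_sin_div_I_mul_cos_div_two hr.ne' hcos.ne', ← hsq, one_div,
    Complex.sq_cpow_two_inv hre]
end

section
/- Let n ≥ 1 be a natural number and θ a real number with -π/2 < θ < π/2. Set ξ = √(2n)·sin(θ) and σ = i·√(2n)·cos(θ) ∈ ℂ, and define the complex numbers Φ₁ = n·Log(σ - ξ) + (ξ² + σξ - n)/2, Φ₂ = n·Log(σ + ξ) + (ξ² - σξ - n)/2 (Log the principal complex logarithm), U₁ = exp(iθ/2)/√(2cos θ), U₂ = exp(-iθ/2)/√(2cos θ). Then (-1)^n·exp(Φ₁)·U₁ + exp(Φ₂)·U₂ = √(2/cos θ) · exp((n/2)·(ln(2n) - cos(2θ))) · cos(Θ), where Θ = n·(sin(2θ)/2 + θ - π/2) + θ/2. In particular the left-hand side is real. -/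
theorem Complex.exp_natCast_mul_log (n : ℕ) {z : ℂ} (hz : z ≠ 0) :
    Complex.exp (n * Complex.log z) = z ^ n := by
  rw [Complex.exp_nat_mul, Complex.exp_log hz]

theorem Real.sqrt_two_div_eq {c : ℝ} (hc : 0 < c) : √(2 / c) = 2 / √(2 * c) := by
  have h : 2 / c = 2 ^ 2 / (2 * c) := by field_simp
  rw [h, Real.sqrt_div (by positivity), Real.sqrt_sq (by positivity)]


open Real in
/-- The oscillatory-region identity `Λ₁ + Λ₂ = √(2/cos θ) exp(Φ₅(θ)) cos Θ` for the
Hermite asymptotics, with `ξ = √(2n) sin θ`, `σ = i√(2n) cos θ`, principal branches,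
and `Θ = n(sin(2θ)/2 + θ - π/2) + θ/2`.  In particular the left-hand side is real. -/
theorem lambda5_oscillatory (n : ℕ) (hn : 1 ≤ n) (θ : ℝ)
    (h1 : -(π / 2) < θ) (h2 : θ < π / 2)
    (ξ : ℝ) (hξ : ξ = Real.sqrt (2 * n) * Real.sin θ)
    (σ : ℂ) (hσ : σ = Complex.I * Real.sqrt (2 * n) * Real.cos θ)
    (Φ₁ Φ₂ U₁ U₂ : ℂ)
    (hΦ₁ : Φ₁ = (n : ℂ) * Complex.log (σ - ξ) + ((ξ : ℂ) ^ 2 + σ * ξ - n) / 2)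
    (hΦ₂ : Φ₂ = (n : ℂ) * Complex.log (σ + ξ) + ((ξ : ℂ) ^ 2 - σ * ξ - n) / 2)
    (hU₁ : U₁ = Complex.exp (Complex.I * θ / 2) / (Real.sqrt (2 * Real.cos θ) : ℂ))
    (hU₂ : U₂ = Complex.exp (-(Complex.I * θ) / 2) / (Real.sqrt (2 * Real.cos θ) : ℂ))
    (Θ : ℝ) (hΘ : Θ = (n : ℝ) * (Real.sin (2 * θ) / 2 + θ - π / 2) + θ / 2) :
    (-1 : ℂ) ^ n * Complex.exp Φ₁ * U₁ + Complex.exp Φ₂ * U₂ =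
      ((Real.sqrt (2 / Real.cos θ) *
        Real.exp (((n : ℝ) / 2) * (Real.log (2 * n) - Real.cos (2 * θ))) *
        Real.cos Θ : ℝ) : ℂ) := by
  have hc : 0 < Real.cos θ := Real.cos_pos_of_mem_Ioo ⟨h1, h2⟩
  have hn0 : (0 : ℝ) < 2 * n := by
    have : (1 : ℝ) ≤ n := by exact_mod_cast hn
    linarith
  set r : ℝ := Real.sqrt (2 * n) with hr
  have hr0 : 0 < r := Real.sqrt_pos.mpr hn0
  have hr2 : (r : ℂ) ^ 2 = 2 * n := by
    rw [← Complex.ofReal_pow, hr, Real.sq_sqrt hn0.le]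
    push_cast
    rfl
  have hlog : (r : ℂ) = Complex.exp ((Real.log (2 * n) / 2 : ℝ) : ℂ) := by
    rw [← Complex.ofReal_exp, ← Real.log_sqrt hn0.le, Real.exp_log hr0]
  have hI : Complex.exp (π / 2 * Complex.I) = Complex.I := Complex.exp_pi_div_two_mul_I
  have hI' : Complex.exp (-(π / 2 * Complex.I)) = -Complex.I := by
    rw [Complex.exp_neg, hI, Complex.inv_I]
  have hplus : σ + ξ =
      Complex.exp ((Real.log (2 * n) / 2 : ℝ) + (π / 2 - θ) * Complex.I) := by
    rw [Complex.exp_add, ← hlog, sub_mul, sub_eq_add_neg, Complex.exp_add, hI, ← neg_mul,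
      Complex.exp_mul_I, Complex.cos_neg, Complex.sin_neg, hσ, hξ]
    push_cast
    linear_combination (r * Complex.sin θ : ℂ) * Complex.I_sq
  have hminus : -(σ - ξ) =
      Complex.exp ((Real.log (2 * n) / 2 : ℝ) + (θ - π / 2) * Complex.I) := by
    rw [Complex.exp_add, ← hlog, sub_mul, sub_eq_add_neg (_ * _), Complex.exp_add, hI',
      Complex.exp_mul_I, hσ, hξ]
    push_cast
    linear_combination (r * Complex.sin θ : ℂ) * Complex.I_sq
  have hplus0 : σ + ξ ≠ 0 := hplus ▸ Complex.exp_ne_zero _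
  have hminus0 : σ - ξ ≠ 0 := neg_ne_zero.mp (hminus ▸ Complex.exp_ne_zero _)
  have hξsq : (ξ : ℂ) ^ 2 - n = -n * Complex.cos (2 * θ) := by
    rw [Complex.cos_two_mul, Complex.cos_sq', hξ]
    push_cast
    linear_combination Complex.sin θ ^ 2 * hr2
  have hσξ : σ * ξ = n * Complex.sin (2 * θ) * Complex.I := by
    rw [Complex.sin_two_mul, hσ, hξ]
    push_cast
    linear_combination Complex.I * Complex.sin θ * Complex.cos θ * hr2
  set E : ℝ := ((n : ℝ) / 2) * (Real.log (2 * n) - Real.cos (2 * θ)) with hE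
  set s : ℝ := Real.sqrt (2 * Real.cos θ) with hs
  have hΛ₁ : (-1 : ℂ) ^ n * Complex.exp Φ₁ * U₁ =
      Complex.exp E * Complex.exp (Θ * Complex.I) / s := by
    rw [hΦ₁, hU₁, Complex.exp_add, Complex.exp_natCast_mul_log n hminus0, ← mul_assoc,
      ← mul_pow, neg_one_mul, hminus, ← Complex.exp_nat_mul, ← mul_div_assoc,
      ← Complex.exp_add, ← Complex.exp_add, ← Complex.exp_add, hE, hΘ]
    congr 2
    push_cast
    linear_combination (hξsq + hσξ) / 2
  have hΛ₂ : Complex.exp Φ₂ * U₂ =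
      Complex.exp E * Complex.exp (-Θ * Complex.I) / s := by
    rw [hΦ₂, hU₂, Complex.exp_add, Complex.exp_natCast_mul_log n hplus0, hplus,
      ← Complex.exp_nat_mul, ← mul_div_assoc,
      ← Complex.exp_add, ← Complex.exp_add, ← Complex.exp_add, hE, hΘ]
    congr 2
    push_cast
    linear_combination (hξsq - hσξ) / 2
  rw [hΛ₁, hΛ₂, Real.sqrt_two_div_eq hc, ← hs]
  push_cast
  rw [← add_div, ← mul_add, ← Complex.two_cos]
  ring
end
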